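/- arXiv:1311.0398 — 3 statements merged into one kernel-verified Lean document; each statement's English description precedes it below -/
import Mathlib

section
/- Let p ∈ ℕ, k ∈ ℕ with k ≥ 1, a : Fin p → ℝ with a_i > 0 for all i, and z : Fin p → ℝ with z_i ≠ 0 for at least one i. Then the function λ ↦ η(λ, p, k, a, z) = Σ_{i=1}^{p} z_i² (λ²/(a_i² + λ²))^k is strictly increasing on (0, ∞). -/
theorem sq_div_add_sq_strictMonoOn {c : ℝ} (hc : 0 < c) :
    StrictMonoOn (fun x : ℝ => x ^ 2 / (c ^ 2 + x ^ 2)) (Set.Ioi 0) := by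
  intro x hx y hy hxy
  have hx0 : 0 < x := hx
  have hy0 : 0 < y := hy
  have hsq : x ^ 2 < y ^ 2 := by gcongr
  have hmul : c ^ 2 * x ^ 2 < c ^ 2 * y ^ 2 := by gcongr
  change x ^ 2 / (c ^ 2 + x ^ 2) < y ^ 2 / (c ^ 2 + y ^ 2)
  rw [div_lt_div_iff₀ (by positivity) (by positivity)]
  linarith

/-- Strict monotonicity of `λ ↦ η(λ, p, k, a, z) = Σ_i z_i² (λ²/(a_i² + λ²))^k` on `(0, ∞)`,
provided all `a_i > 0`, `k ≥ 1`, and some `z_i ≠ 0`. -/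
theorem eta_strictMonoOn
    (p k : ℕ) (hk : 1 ≤ k) (a z : Fin p → ℝ)
    (ha : ∀ i, 0 < a i) (hz : ∃ i, z i ≠ 0) :
    StrictMonoOn (fun lam : ℝ => ∑ i, (z i) ^ 2 * (lam ^ 2 / ((a i) ^ 2 + lam ^ 2)) ^ k)
      (Set.Ioi (0 : ℝ)) := by
  intro x hx y hy hxy
  have hpow (i : Fin p) :
      (x ^ 2 / ((a i) ^ 2 + x ^ 2)) ^ k < (y ^ 2 / ((a i) ^ 2 + y ^ 2)) ^ k :=
    pow_lt_pow_left₀ (sq_div_add_sq_strictMonoOn (ha i) hx hy hxy) (by positivity) (by omega)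
  obtain ⟨j, hj⟩ := hz
  exact Finset.sum_lt_sum
    (fun i _ => mul_le_mul_of_nonneg_left (hpow i).le (sq_nonneg _))
    ⟨j, Finset.mem_univ j, mul_lt_mul_of_pos_left (hpow j) (by positivity)⟩
end

section
/- Let p ∈ ℕ, k ∈ ℕ with k ≥ 1, and 0 < l < L. Let a^{(n)}, z^{(n)} : Fin p → ℝ with a^{(n)}_i → α_i and z^{(n)}_i → ζ_i for each i, where α_i > 0 for all i and ζ_i ≠ 0 for at least one i. Let τ ∈ ℝ, and suppose λ^{(n)} ∈ [l, L] satisfy η(λ^{(n)}, p, k, a^{(n)}, z^{(n)}) = τ for all n, and λ* ∈ [l, L] satisfies η(λ*, p, k, α, ζ) = τ. Then λ^{(n)} → λ* as n → ∞. -/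
open Filter

theorem Finset.strictMonoOn_sum_sq_mul_div_pow {ι : Type*} (s : Finset ι) {k : ℕ} (hk : k ≠ 0)
    {α ζ : ι → ℝ} (hα : ∀ i ∈ s, α i ≠ 0) (hζ : ∃ i ∈ s, ζ i ≠ 0) :
    StrictMonoOn (fun x : ℝ => ∑ i ∈ s, ζ i ^ 2 * (x ^ 2 / (α i ^ 2 + x ^ 2)) ^ k)
      (Set.Ioi 0) := by
  intro x hx y hy hxy
  have hx0 : 0 < x := hx
  have hy0 : 0 < y := hy
  have hlt : ∀ i ∈ s,
      (x ^ 2 / (α i ^ 2 + x ^ 2)) ^ k < (y ^ 2 / (α i ^ 2 + y ^ 2)) ^ k := by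
    intro i hi
    have hαi : 0 < α i ^ 2 := by have := hα i hi; positivity
    have hsq : x ^ 2 < y ^ 2 := by gcongr
    refine pow_lt_pow_left₀ ?_ (by positivity) hk
    rw [div_lt_div_iff₀ (by positivity) (by positivity)]
    linarith [mul_lt_mul_of_pos_left hsq hαi]
  obtain ⟨j, hj, hζj⟩ := hζ
  exact Finset.sum_lt_sum
    (fun i hi => mul_le_mul_of_nonneg_left (hlt i hi).le (sq_nonneg _))
    ⟨j, hj, mul_lt_mul_of_pos_left (hlt j hj) (by positivity)⟩

/-- Convergence of the regularization parameters selected as roots of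
`η(λ, p, k, a^{(n)}, z^{(n)}) = τ` to the root `λ*` of the limiting equation
`η(λ, p, k, α, ζ) = τ`, within a fixed interval `[l, L] ⊂ (0, ∞)`. -/
theorem root_parameters_converge
    (p k : ℕ) (hk : 1 ≤ k) (l L : ℝ) (hl : 0 < l) (hlL : l < L)
    (a z : ℕ → Fin p → ℝ) (α ζ : Fin p → ℝ)
    (hα : ∀ i, 0 < α i) (hζ : ∃ i, ζ i ≠ 0)
    (ha : ∀ i, Tendsto (fun n => a n i) atTop (nhds (α i)))
    (hz : ∀ i, Tendsto (fun n => z n i) atTop (nhds (ζ i)))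
    (τ : ℝ) (lamn : ℕ → ℝ) (hmem : ∀ n, lamn n ∈ Set.Icc l L)
    (heq : ∀ n, ∑ i, (z n i) ^ 2 * ((lamn n) ^ 2 / ((a n i) ^ 2 + (lamn n) ^ 2)) ^ k = τ)
    (lamstar : ℝ) (hstar : lamstar ∈ Set.Icc l L)
    (heqstar : ∑ i, (ζ i) ^ 2 * (lamstar ^ 2 / ((α i) ^ 2 + lamstar ^ 2)) ^ k = τ) :
    Tendsto lamn atTop (nhds lamstar) := by
  refine tendsto_of_subseq_tendsto fun ns hns => ?_
  obtain ⟨x, hx, φ, hφ, hlim⟩ := isCompact_Icc.tendsto_subseq fun n => hmem (ns n)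
  refine ⟨φ, ?_⟩
  have hx0 : 0 < x := hl.trans_le hx.1
  have hsub : Tendsto (fun n => ns (φ n)) atTop atTop := hns.comp hφ.tendsto_atTop
  have hsum : Tendsto
      (fun n => ∑ i, z (ns (φ n)) i ^ 2 *
        (lamn (ns (φ n)) ^ 2 / (a (ns (φ n)) i ^ 2 + lamn (ns (φ n)) ^ 2)) ^ k)
      atTop (nhds (∑ i, ζ i ^ 2 * (x ^ 2 / (α i ^ 2 + x ^ 2)) ^ k)) :=
    tendsto_finsetSum _ fun i _ =>
      (((hz i).comp hsub).pow 2).mul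
        (((hlim.pow 2).div ((((ha i).comp hsub).pow 2).add (hlim.pow 2))
          (by positivity)).pow k)
  simp only [heq] at hsum
  have hroot := tendsto_nhds_unique hsum tendsto_const_nhds
  have hmono := Finset.univ.strictMonoOn_sum_sq_mul_div_pow (Nat.one_le_iff_ne_zero.mp hk)
    (fun i _ => (hα i).ne') (by simpa using hζ)
  rwa [← hmono.injOn hx0 (hl.trans_le hstar.1) (hroot.trans heqstar.symm)]
end

section
/- Let p ∈ ℕ, ζ² > 0, and 0 < l < L. Define, for vectors a, z : Fin p → ℝ, the UPRE functional U(λ; a, z) = Σ_{i=1}^{p} z_i² (λ²/(a_i² + λ²))² + 2ζ² Σ_{i=1}^{p} a_i²/(a_i² + λ²). Let a^{(n)}, z^{(n)} : Fin p → ℝ with a^{(n)}_i → α_i and z^{(n)}_i → ζ_i for each i, α_i > 0. Suppose λ* is the unique minimizer of λ ↦ U(λ; α, ζvec) over [l, L], and for each n, λ^{(n)} is a minimizer of λ ↦ U(λ; a^{(n)}, z^{(n)}) over [l, L]. Then λ^{(n)} → λ* as n → ∞. -/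
open Filter

/-- If minimizers `x n` of `f n` over a compact set `s` are taken along functions converging
continuously to `g`, and `x₀` is the only minimizer of `g` over `s`, then `x n` tends to `x₀`. -/
theorem IsCompact.tendsto_of_isMinOn_of_unique {ι X : Type*} [TopologicalSpace X]
    {F : Filter ι} {s : Set X} (hs : IsCompact s) {f : ι → X → ℝ} {g : X → ℝ} {x : ι → X} {x₀ : X}
    (hx₀ : x₀ ∈ s) (huniq : ∀ y ∈ s, y ≠ x₀ → g x₀ < g y)
    (hx : ∀ n, x n ∈ s) (hmin : ∀ n, IsMinOn (f n) s (x n))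
    (hfg : ∀ (G : Filter ι) (u : ι → X) (y : X), G ≤ F → y ∈ s → Tendsto u G (nhds y) →
      Tendsto (fun n => f n (u n)) G (nhds (g y))) :
    Tendsto x F (nhds x₀) := by
  refine hs.tendsto_nhds_of_unique_mapClusterPt (Eventually.of_forall hx) fun y hy hc => ?_
  obtain ⟨G, hGF, hG⟩ := mapClusterPt_iff_ultrafilter.1 hc
  have hle : g y ≤ g x₀ :=
    le_of_tendsto_of_tendsto' (hfg G x y hGF hy hG)
      (hfg G (fun _ => x₀) x₀ hGF hx₀ tendsto_const_nhds) fun n => hmin n hx₀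
  by_contra hne
  exact (huniq y hy hne).not_ge hle

/-- Convergence of UPRE-selected regularization parameters: if `λ*` is the unique minimizer
over `[l, L]` of the limiting UPRE functional and `λ^{(n)}` minimizes the discrete UPRE
functional over `[l, L]`, then `λ^{(n)} → λ*`. -/
theorem upre_parameters_converge
    (p : ℕ) (ns2 : ℝ) (hns2 : 0 < ns2) (l L : ℝ) (hl : 0 < l) (hlL : l < L)
    (U : (Fin p → ℝ) → (Fin p → ℝ) → ℝ → ℝ)
    (hU : ∀ a z lam, U a z lam =
      ∑ i, (z i) ^ 2 * (lam ^ 2 / ((a i) ^ 2 + lam ^ 2)) ^ 2 +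
        2 * ns2 * ∑ i, (a i) ^ 2 / ((a i) ^ 2 + lam ^ 2))
    (a z : ℕ → Fin p → ℝ) (α ζvec : Fin p → ℝ)
    (hα : ∀ i, 0 < α i)
    (ha : ∀ i, Tendsto (fun n => a n i) atTop (nhds (α i)))
    (hz : ∀ i, Tendsto (fun n => z n i) atTop (nhds (ζvec i)))
    (lamstar : ℝ) (hstarmem : lamstar ∈ Set.Icc l L)
    (hstarmin : ∀ lam ∈ Set.Icc l L, U α ζvec lamstar ≤ U α ζvec lam)
    (hstaruniq : ∀ lam ∈ Set.Icc l L, lam ≠ lamstar → U α ζvec lamstar < U α ζvec lam)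
    (lamn : ℕ → ℝ) (hmem : ∀ n, lamn n ∈ Set.Icc l L)
    (hmin : ∀ n, ∀ lam ∈ Set.Icc l L, U (a n) (z n) (lamn n) ≤ U (a n) (z n) lam) :
    Tendsto lamn atTop (nhds lamstar) := by
  refine isCompact_Icc.tendsto_of_isMinOn_of_unique (f := fun n => U (a n) (z n)) hstarmem
    hstaruniq hmem (fun n lam hlam => hmin n lam hlam) fun G u y hG hy hu => ?_
  have hy0 : 0 < y := hl.trans_le hy.1
  have hden (i : Fin p) : (α i) ^ 2 + y ^ 2 ≠ 0 := by positivity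
  have ha' (i : Fin p) := (ha i).mono_left hG
  have hz' (i : Fin p) := (hz i).mono_left hG
  have hsum (i : Fin p) := ((ha' i).pow 2).add (hu.pow 2)
  simp only [hU]
  exact (tendsto_finsetSum _ fun i _ =>
    ((hz' i).pow 2).mul (((hu.pow 2).div (hsum i) (hden i)).pow 2)).add
    ((tendsto_finsetSum _ fun i _ => ((ha' i).pow 2).div (hsum i) (hden i)).const_mul _)
end
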